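/- Let R be a commutative Noetherian ring, I and J ideals of R, M and N finitely generated R-modules, and i ≥ 0 a fixed integer. If the R-module Tor_i^R(I^n M, N/J^m N) has finite length for all sufficiently large m and n, then there exist a polynomial p ∈ ℚ[x,y] and integers m₀, n₀ such that length_R(Tor_i^R(I^n M, N/J^m N)) = p(m,n) for all m ≥ m₀ and n ≥ n₀. -/

import Mathlib

open CategoryTheory

/-- `Tor_i^R(M, N)` as an object of `ModuleCat R`. -/
noncomputable def TorM (R : Type) [CommRing R] (i : ℕ)
    (M : Type) [AddCommGroup M] [Module R M]
    (N : Type) [AddCommGroup N] [Module R N] : ModuleCat R :=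
  ((Tor (ModuleCat R) i).obj (ModuleCat.of R M)).obj (ModuleCat.of R N)

/-- The length of a module: the Krull dimension of its lattice of submodules. -/
noncomputable def modLength (R : Type) [CommRing R]
    (M : Type) [AddCommGroup M] [Module R M] : WithBot ℕ∞ :=
  Order.krullDim (Submodule R M)

section RelativeLength

variable {R : Type} [CommRing R]
  {P : Type} [AddCommGroup P] [Module R P] {Q : Type} [AddCommGroup Q] [Module R Q]

/-- The length of `U ⧸ V` for submodules `V ≤ U`. -/
noncomputable def relLen (V U : Submodule R P) : ℕ∞ :=
  Module.length R (U ⧸ V.comap U.subtype)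

theorem relLen_eq_zero_of_le {V U : Submodule R P} (h : U ≤ V) : relLen V U = 0 := by
  rw [relLen, Module.length_eq_zero_iff, Submodule.Quotient.subsingleton_iff,
    Submodule.comap_subtype_eq_top]
  exact h

theorem relLen_add {V W U : Submodule R P} (h₁ : V ≤ W) (h₂ : W ≤ U) :
    relLen V U = relLen V W + relLen W U := by
  have hf : V.comap W.subtype ≤ (V.comap U.subtype).comap (Submodule.inclusion h₂) :=
    fun x hx => hx
  have hg : V.comap U.subtype ≤ (W.comap U.subtype).comap LinearMap.id := fun x hx => h₁ hx
  refine Module.length_eq_add_of_exact (f := Submodule.mapQ _ _ _ hf)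
    (g := Submodule.mapQ _ _ _ hg) ?_ ?_ ?_
  · rw [← LinearMap.ker_eq_bot, LinearMap.ker_eq_bot']
    intro x
    obtain ⟨x, rfl⟩ := Submodule.Quotient.mk_surjective _ x
    intro hx
    rw [Submodule.mapQ_apply, Submodule.Quotient.mk_eq_zero] at hx
    rw [Submodule.Quotient.mk_eq_zero]
    exact hx
  · intro x
    obtain ⟨x, rfl⟩ := Submodule.Quotient.mk_surjective _ x
    exact ⟨Submodule.Quotient.mk x, rfl⟩
  · intro x
    obtain ⟨x, rfl⟩ := Submodule.Quotient.mk_surjective _ x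
    rw [Submodule.mapQ_apply, Submodule.Quotient.mk_eq_zero]
    constructor
    · intro hx
      exact ⟨Submodule.Quotient.mk ⟨x.1, hx⟩, rfl⟩
    · rintro ⟨y, hy⟩
      obtain ⟨y, rfl⟩ := Submodule.Quotient.mk_surjective _ y
      rw [Submodule.mapQ_apply, Submodule.Quotient.eq] at hy
      have h : (y : P) - x ∈ V := hy
      have := W.sub_mem y.2 (h₁ h)
      rw [sub_sub_cancel] at this
      exact this

theorem relLen_comap (z : P →ₗ[R] Q) (U : Submodule R P) (V : Submodule R Q) :
    relLen (U ⊓ V.comap z) U = relLen V (V ⊔ U.map z) := by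
  have hz : ∀ u : U, z.comp U.subtype u ∈ V ⊔ U.map z := fun u =>
    Submodule.mem_sup_right (Submodule.mem_map_of_mem u.2)
  set g : U →ₗ[R] (↥(V ⊔ U.map z) ⧸ V.comap (V ⊔ U.map z).subtype) :=
    (Submodule.mkQ _).comp (LinearMap.codRestrict (V ⊔ U.map z) (z.comp U.subtype) hz) with hg
  have hker : LinearMap.ker g = (U ⊓ V.comap z).comap U.subtype := by
    ext u
    rw [LinearMap.mem_ker, hg, LinearMap.comp_apply, Submodule.mkQ_apply,
      Submodule.Quotient.mk_eq_zero]
    simp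
  have hsurj : Function.Surjective g := by
    intro x
    obtain ⟨⟨x, hx⟩, rfl⟩ := Submodule.Quotient.mk_surjective _ x
    obtain ⟨v, hv, y, ⟨u, hu, rfl⟩, rfl⟩ := Submodule.mem_sup.1 hx
    refine ⟨⟨u, hu⟩, ?_⟩
    rw [hg, LinearMap.comp_apply, Submodule.mkQ_apply, Submodule.Quotient.eq]
    change z u - (v + z u) ∈ V
    simpa using hv
  rw [relLen, relLen, ← (Submodule.quotEquivOfEq _ _ hker).length_eq]
  exact (g.quotKerEquivOfSurjective hsurj).length_eq

/-- Euler characteristic of the map induced on subquotients. -/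
theorem relLen_add_cokernel (z : P →ₗ[R] Q) {V U : Submodule R P} {V' U' : Submodule R Q}
    (hVU : V ≤ U) (hVU' : V' ≤ U') (hV : V ≤ V'.comap z) (hU : U ≤ U'.comap z) :
    relLen V U + relLen (V' ⊔ U.map z) U' = relLen V' U' + relLen V (U ⊓ V'.comap z) := by
  rw [relLen_add (le_inf hVU hV) inf_le_left, relLen_comap,
    relLen_add (V := V') (W := V' ⊔ U.map z) le_sup_left
      (sup_le hVU' (Submodule.map_le_iff_le_comap.2 hU))]
  ring

theorem relLen_map (z : P →ₗ[R] Q) {V U : Submodule R P} (hVU : V ≤ U)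
    (hz : LinearMap.ker z ≤ V) : relLen (V.map z) (U.map z) = relLen V U := by
  have := relLen_comap z U (V.map z)
  rw [sup_eq_right.2 (Submodule.map_mono hVU), Submodule.comap_map_eq, sup_eq_left.2 hz,
    inf_eq_right.2 hVU] at this
  exact this.symm

theorem relLen_bot (U : Submodule R P) : relLen ⊥ U = Module.length R U := by
  have h : (⊥ : Submodule R P).comap U.subtype = ⊥ := by
    ext x; simp
  exact ((Submodule.quotEquivOfEqBot _ h)).length_eq

theorem relLen_mono_right {V U U' : Submodule R P} (hV : V ≤ U) (h : U ≤ U') :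
    relLen V U ≤ relLen V U' := by
  rw [relLen_add hV h]; exact le_self_add

theorem relLen_anti_left {V V' U : Submodule R P} (hV : V ≤ V') (h : V' ≤ U) :
    relLen V' U ≤ relLen V U := by
  rw [relLen_add hV h]; exact le_add_self

end RelativeLength

/-- A graded family of `R`-modules `X 0, X 1, …` with `a` commuting operators of degree one. -/
structure GradedOp (R : Type) [CommRing R] (a : ℕ) where
  carrier : ℕ → Type
  [addCommGroup : ∀ n, AddCommGroup (carrier n)]
  [module : ∀ n, Module R (carrier n)]
  op : Fin a → ∀ n, carrier n →ₗ[R] carrier (n + 1)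
  comm : ∀ k l n v, op k (n + 1) (op l n v) = op l (n + 1) (op k n v)

namespace GradedOp

attribute [instance] GradedOp.addCommGroup GradedOp.module

open DirectSum

variable {R : Type} [CommRing R] {a : ℕ} (X : GradedOp R a)

/-- The operator `X.op k` on the direct sum of all components. -/
noncomputable def totalOp (k : Fin a) : Module.End R (⨁ n, X.carrier n) :=
  DirectSum.toModule R ℕ _ fun n => (DirectSum.lof R ℕ X.carrier (n + 1)).comp (X.op k n)

theorem totalOp_lof (k : Fin a) (n : ℕ) (v : X.carrier n) :
    X.totalOp k (DirectSum.lof R ℕ X.carrier n v) =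
      DirectSum.lof R ℕ X.carrier (n + 1) (X.op k n v) := by
  simp [totalOp]

theorem totalOp_apply_succ (k : Fin a) (f : ⨁ n, X.carrier n) (n : ℕ) :
    X.totalOp k f (n + 1) = X.op k n (f n) := by
  induction f using DirectSum.induction_on with
  | zero => simp
  | of i v =>
    rw [← DirectSum.lof_eq_of R, totalOp_lof]
    rcases eq_or_ne i n with rfl | h
    · simp
    · simp only [DirectSum.lof_eq_of]
      rw [DirectSum.of_eq_of_ne _ _ _ (by simpa using h.symm), DirectSum.of_eq_of_ne _ _ _ h.symm,
        map_zero]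
  | add f g hf hg => simp [hf, hg]

theorem totalOp_apply_zero (k : Fin a) (f : ⨁ n, X.carrier n) : X.totalOp k f 0 = 0 := by
  induction f using DirectSum.induction_on with
  | zero => simp
  | of i v =>
    rw [← DirectSum.lof_eq_of R, totalOp_lof, DirectSum.lof_eq_of,
      DirectSum.of_eq_of_ne _ _ _ (by simp)]
  | add f g hf hg => simp [hf, hg]

theorem totalOp_comm (k l : Fin a) : X.totalOp k * X.totalOp l = X.totalOp l * X.totalOp k := by
  refine DirectSum.linearMap_ext R fun n => LinearMap.ext fun v => ?_
  simp [totalOp_lof, X.comm k l]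

/-- The algebra generated by the operators. -/
noncomputable def alg : Subalgebra R (Module.End R (⨁ n, X.carrier n)) :=
  Algebra.adjoin R (Set.range X.totalOp)

open scoped IsMulCommutative in
noncomputable instance : CommRing X.alg :=
  have : IsMulCommutative (Algebra.adjoin R (Set.range X.totalOp)) :=
    Algebra.isMulCommutative_adjoin R (by
      rintro _ ⟨k, rfl⟩ _ ⟨l, rfl⟩
      exact X.totalOp_comm k l)
  inferInstanceAs (CommRing (Algebra.adjoin R (Set.range X.totalOp)))

instance [IsNoetherianRing R] : IsNoetherianRing X.alg :=
  have : Algebra.FiniteType R X.alg :=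
    (Subalgebra.fg_iff_finiteType _).1
      (Subalgebra.fg_def.2 ⟨_, Set.finite_range X.totalOp, rfl⟩)
  Algebra.FiniteType.isNoetherianRing R X.alg

/-- The class of `X.op k` in `X.alg`. -/
noncomputable def gen (k : Fin a) : X.alg := ⟨X.totalOp k, Algebra.subset_adjoin ⟨k, rfl⟩⟩

theorem gen_smul (k : Fin a) (f : ⨁ n, X.carrier n) : X.gen k • f = X.totalOp k f := rfl

/-- A family of submodules stable under the operators. -/
def Stable (U : ∀ n, Submodule R (X.carrier n)) : Prop :=
  ∀ k n, U n ≤ (U (n + 1)).comap (X.op k n)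

variable {X}

/-- The `X.alg`-submodule of the total module given by a stable family. -/
noncomputable def Stable.total {U : ∀ n, Submodule R (X.carrier n)} (hU : X.Stable U) :
    Submodule X.alg (⨁ n, X.carrier n) where
  carrier := {f | ∀ n, f n ∈ U n}
  add_mem' hf hg n := (U n).add_mem (hf n) (hg n)
  zero_mem' n := (U n).zero_mem
  smul_mem' := by
    rintro ⟨c, hc⟩ f hf
    change ∀ n, (c f) n ∈ U n
    induction hc using Algebra.adjoin_induction generalizing f with
    | mem c hc =>
      obtain ⟨k, rfl⟩ := hc
      rintro (_ | n)
      · rw [totalOp_apply_zero]; exact zero_mem _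
      · rw [totalOp_apply_succ]; exact hU k n (hf n)
    | algebraMap r => exact fun n => (U n).smul_mem r (hf n)
    | add c d _ _ hc hd => exact fun n => (U n).add_mem (hc hf n) (hd hf n)
    | mul c d _ _ hc hd => exact hc (hd hf)

theorem Stable.mem_total {U : ∀ n, Submodule R (X.carrier n)} (hU : X.Stable U)
    {f : ⨁ n, X.carrier n} : f ∈ hU.total ↔ ∀ n, f n ∈ U n := Iff.rfl

theorem Stable.lof_mem_total {U : ∀ n, Submodule R (X.carrier n)} (hU : X.Stable U)
    {n : ℕ} {v : X.carrier n} (hv : v ∈ U n) : DirectSum.lof R ℕ X.carrier n v ∈ hU.total := by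
  intro i
  rcases eq_or_ne i n with rfl | h
  · simpa using hv
  · rw [DirectSum.lof_eq_of, DirectSum.of_eq_of_ne _ _ _ h]
    exact zero_mem _

variable (X)

/-- The graded family is finitely generated. -/
structure FG : Prop where
  finite : ∀ n, Module.Finite R (X.carrier n)
  generated : ∃ c, ∀ n ≥ c, ⨆ k, LinearMap.range (X.op k n) = ⊤

variable {X}

theorem mem_of_forall_lof_mem {S : Type} [SetLike S (⨁ n, X.carrier n)]
    [AddSubmonoidClass S (⨁ n, X.carrier n)] (T : S) (f : ⨁ n, X.carrier n)
    (h : ∀ n, DirectSum.lof R ℕ X.carrier n (f n) ∈ T) : f ∈ T := by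
  classical
  rw [← DirectSum.sum_support_of f]
  exact sum_mem fun n _ => h n

theorem FG.finite_total (hX : X.FG) : Module.Finite X.alg (⨁ n, X.carrier n) := by
  obtain ⟨c, hc⟩ := hX.generated
  have := hX.finite
  choose s hs using fun n => (this n).fg_top
  classical
  let t : Finset (⨁ n, X.carrier n) :=
    (Finset.range (c + 1)).biUnion fun n => (s n).image (DirectSum.lof R ℕ X.carrier n)
  refine ⟨⟨t, ?_⟩⟩
  rw [eq_top_iff]
  intro f _
  refine mem_of_forall_lof_mem _ f fun n => ?_
  generalize f n = v
  let T := (Submodule.span X.alg (t : Set (⨁ n, X.carrier n))).restrictScalars R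
  have base : ∀ n ≤ c, ⊤ ≤ T.comap (DirectSum.lof R ℕ X.carrier n) := by
    intro n h
    rw [← hs n, Submodule.span_le]
    intro v hv
    refine Submodule.subset_span ?_
    simp only [t, Finset.coe_biUnion, Finset.coe_image, Set.mem_iUnion]
    exact ⟨n, by simpa [Nat.lt_succ_iff] using h, v, hv, rfl⟩
  have key : ∀ n, ⊤ ≤ T.comap (DirectSum.lof R ℕ X.carrier n) := by
    intro n
    induction n with
    | zero => exact base 0 (Nat.zero_le c)
    | succ n ih =>
      rcases Nat.lt_or_ge n c with h | h
      · exact base (n + 1) h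
      · rw [← hc n h, iSup_le_iff]
        rintro k _ ⟨v, rfl⟩
        have hv : DirectSum.lof R ℕ X.carrier n v ∈ Submodule.span X.alg (t : Set _) :=
          ih (x := v) trivial
        have := Submodule.smul_mem _ (X.gen k) hv
        rw [gen_smul, totalOp_lof] at this
        exact this
  exact key n trivial

/-- A stable family in a finitely generated graded family is finitely generated. -/
theorem FG.exists_eq_iSup_map [IsNoetherianRing R] (hX : X.FG)
    {U : ∀ n, Submodule R (X.carrier n)} (hU : X.Stable U) :
    ∃ c, ∀ n ≥ c, U (n + 1) = ⨆ k, (U n).map (X.op k n) := by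
  classical
  have := hX.finite_total
  obtain ⟨t, ht⟩ := IsNoetherian.noetherian (R := X.alg) hU.total
  let c := t.sup fun f => f.support.sup id
  have hle : ∀ n, ⨆ k, (U n).map (X.op k n) ≤ U (n + 1) := fun n =>
    iSup_le fun k => Submodule.map_le_iff_le_comap.2 (hU k n)
  let G : ∀ n, Submodule R (X.carrier n) := fun
    | 0 => U 0
    | n + 1 => if n < c then U (n + 1) else ⨆ k, (U n).map (X.op k n)
  have hGU : ∀ n, G n ≤ U n := by
    rintro (_ | n)
    · exact le_rfl
    · simp only [G]; split_ifs
      exacts [le_rfl, hle n]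
  have hUG : ∀ n, n ≤ c → G n = U n := by
    rintro (_ | n) h
    · rfl
    · simp only [G]; rw [if_pos (by omega)]
  have hG : X.Stable G := by
    intro k n
    refine (hGU n).trans ?_
    simp only [G]; split_ifs
    · exact hU k n
    · exact Submodule.map_le_iff_le_comap.1 (le_iSup (fun k => (U n).map (X.op k n)) k)
  have hUG' : hU.total ≤ hG.total := by
    rw [← ht, Submodule.span_le]
    intro f hf n
    by_cases h : f n = 0
    · rw [h]; exact zero_mem _
    · have hfU : f ∈ hU.total := ht ▸ Submodule.subset_span hf
      rw [hUG n]
      · exact hfU n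
      · have h1 : n ≤ f.support.sup id :=
          Finset.le_sup (f := id) (DFinsupp.mem_support_iff.2 h)
        exact h1.trans (Finset.le_sup (f := fun f => f.support.sup id) hf)
  refine ⟨c, fun n hn => le_antisymm (fun v hv => ?_) (hle n)⟩
  have := hUG' (hU.lof_mem_total hv) (n + 1)
  simp only [DirectSum.lof_apply, G, if_neg (not_lt.2 hn)] at this
  exact this

/-- A decreasing family of stable families which is compatible with the `J`-adic filtration. -/
structure IsFiltration (X : GradedOp R a) (J : Ideal R)
    (U : ℕ → ∀ n, Submodule R (X.carrier n)) : Prop where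
  stable : ∀ m, X.Stable (U m)
  anti : ∀ m n, U (m + 1) n ≤ U m n
  smul_le : ∀ m n, J • U m n ≤ U (m + 1) n

theorem Stable.ideal_smul {U : ∀ n, Submodule R (X.carrier n)} (hU : X.Stable U) (J : Ideal R) :
    X.Stable fun n => J • U n := by
  intro k n
  rw [← Submodule.map_le_iff_le_comap, Submodule.map_smul'']
  exact Submodule.smul_mono le_rfl (Submodule.map_le_iff_le_comap.2 (hU k n))

theorem Stable.map_smul_total_le {U V : ∀ n, Submodule R (X.carrier n)} (hU : X.Stable U)
    (hV : X.Stable V) {J : Ideal R} (h : ∀ n, J • U n ≤ V n) :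
    J.map (algebraMap R X.alg) • hU.total ≤ hV.total := by
  have : J.map (algebraMap R X.alg) ≤ hV.total.colon hU.total := by
    rw [Ideal.map_le_iff_le_comap]
    intro r hr
    rw [Ideal.mem_comap, Submodule.mem_colon]
    intro f hf n
    exact h n (Submodule.smul_mem_smul hr (hf n))
  rw [Submodule.smul_le]
  intro r hr f hf
  exact Submodule.mem_colon.1 (this hr) f hf

/-- Artin-Rees for graded families. -/
theorem FG.exists_smul_eq [IsNoetherianRing R] (hX : X.FG) {J : Ideal R}
    {U : ℕ → ∀ n, Submodule R (X.carrier n)} (hU : X.IsFiltration J U)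
    (hle : ∀ m n, U m n ≤ J ^ m • ⊤) :
    ∃ c, ∀ m ≥ c, ∀ n, U (m + 1) n = J • U m n := by
  have := hX.finite_total
  let J' := J.map (algebraMap R X.alg)
  let F : J'.Filtration (⨁ n, X.carrier n) :=
    { N := fun m => (hU.stable m).total
      mono := fun m f hf n => hU.anti m n (hf n)
      smul_le := fun m => (hU.stable m).map_smul_total_le (hU.stable (m + 1)) (hU.smul_le m) }
  have hF : F ≤ J'.stableFiltration ⊤ := by
    intro m f hf
    refine mem_of_forall_lof_mem _ f fun n => ?_
    have hfn : f n ∈ J ^ m • (⊤ : Submodule R (X.carrier n)) := hle m n (hf n)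
    change _ ∈ J' ^ m • (⊤ : Submodule X.alg (⨁ n, X.carrier n))
    generalize f n = v at hfn
    refine Submodule.smul_induction_on hfn (fun r hr v _ => ?_) (fun u v hu hv => ?_)
    · rw [map_smul, ← algebraMap_smul X.alg r]
      refine Submodule.smul_mem_smul ?_ trivial
      rw [← Ideal.map_pow]
      exact Ideal.mem_map_of_mem _ hr
    · rw [map_add]
      exact add_mem hu hv
  obtain ⟨c, hc⟩ := (J'.stableFiltration_stable ⊤).of_le hF
  refine ⟨c, fun m hm n => le_antisymm (fun v hv => ?_) (hU.smul_le m n)⟩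
  have h1 := (hU.stable m).map_smul_total_le ((hU.stable m).ideal_smul J) (fun n => le_rfl)
  have h2 : DirectSum.lof R ℕ X.carrier n v ∈ J' • (hU.stable m).total :=
    (hc m hm).symm ▸ (hU.stable (m + 1)).lof_mem_total hv
  have h3 := h1 h2 n
  simpa using h3

theorem FG.exists_le_of_smul_le [IsNoetherianRing R] (hX : X.FG) {J : Ideal R}
    {U V : ℕ → ∀ n, Submodule R (X.carrier n)} (hU : X.IsFiltration J U)
    (hle : ∀ m n, U m n ≤ J ^ m • ⊤) (h : ∀ m n, J • U m n ≤ V (m + 1) n) :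
    ∃ c, ∀ m ≥ c, ∀ n, U m n ≤ V m n := by
  obtain ⟨c, hc⟩ := hX.exists_smul_eq hU hle
  refine ⟨c + 1, fun m hm n => ?_⟩
  obtain ⟨m, rfl⟩ : ∃ k, m = k + 1 := ⟨m - 1, by omega⟩
  rw [hc m (by omega)]
  exact h m n

theorem FG.exists_le_of_map_le [IsNoetherianRing R] (hX : X.FG) {J : Ideal R}
    {U V : ℕ → ∀ n, Submodule R (X.carrier n)} (hU : X.IsFiltration J U)
    (hV : X.IsFiltration J V) (hle : ∀ m n, U m n ≤ J ^ m • ⊤)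
    (h : ∀ m n k, (U m n).map (X.op k n) ≤ V m (n + 1)) :
    ∃ c, ∀ n ≥ c, ∀ m, U m n ≤ V m n := by
  obtain ⟨c, hc⟩ := hX.exists_smul_eq hU hle
  choose d hd using fun m => hX.exists_eq_iSup_map (hU.stable m)
  refine ⟨(Finset.range (c + 1)).sup d + 1, fun n hn m => ?_⟩
  have base : ∀ m ≤ c, U m n ≤ V m n := by
    intro m hm
    obtain ⟨n, rfl⟩ : ∃ k, n = k + 1 := ⟨n - 1, by omega⟩
    have hdm : d m ≤ (Finset.range (c + 1)).sup d := Finset.le_sup (by simpa using by omega)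
    rw [hd m n (by omega)]
    exact iSup_le fun k => h m n k
  induction m with
  | zero => exact base 0 (Nat.zero_le c)
  | succ m ih =>
    rcases Nat.lt_or_ge m c with h | h
    · exact base _ h
    · rw [hc m h]
      exact (Submodule.smul_mono le_rfl ih).trans (hV.smul_le m n)

end GradedOp

theorem MvPolynomial.eval_bind₁_eq {σ τ S : Type} [CommSemiring S] (x : τ → S)
    (q : σ → MvPolynomial τ S) (p : MvPolynomial σ S) :
    MvPolynomial.eval x (MvPolynomial.bind₁ q p) =
      MvPolynomial.eval (fun i => MvPolynomial.eval x (q i)) p :=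
  MvPolynomial.eval₂Hom_bind₁ _ _ _ _

/-- `g` is eventually given by a polynomial with rational coefficients. -/
def IsEvPoly (g : ℕ → ℕ → ℚ) : Prop :=
  ∃ (p : MvPolynomial (Fin 2) ℚ) (c : ℕ), ∀ m ≥ c, ∀ n ≥ c,
    g m n = MvPolynomial.eval ![(m : ℚ), (n : ℚ)] p

namespace IsEvPoly

theorem const (q : ℚ) : IsEvPoly fun _ _ => q :=
  ⟨MvPolynomial.C q, 0, fun _ _ _ _ => by simp⟩

theorem add {f g : ℕ → ℕ → ℚ} (hf : IsEvPoly f) (hg : IsEvPoly g) :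
    IsEvPoly fun m n => f m n + g m n := by
  obtain ⟨p, c, hp⟩ := hf
  obtain ⟨q, d, hq⟩ := hg
  refine ⟨p + q, max c d, fun m hm n hn => ?_⟩
  beta_reduce
  rw [map_add, hp m (le_of_max_le_left hm) n (le_of_max_le_left hn),
    hq m (le_of_max_le_right hm) n (le_of_max_le_right hn)]

theorem sub {f g : ℕ → ℕ → ℚ} (hf : IsEvPoly f) (hg : IsEvPoly g) :
    IsEvPoly fun m n => f m n - g m n := by
  obtain ⟨p, c, hp⟩ := hf
  obtain ⟨q, d, hq⟩ := hg
  refine ⟨p - q, max c d, fun m hm n hn => ?_⟩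
  beta_reduce
  rw [map_sub, hp m (le_of_max_le_left hm) n (le_of_max_le_left hn),
    hq m (le_of_max_le_right hm) n (le_of_max_le_right hn)]

theorem congr {f g : ℕ → ℕ → ℚ} (hf : IsEvPoly f)
    (h : ∃ c, ∀ m ≥ c, ∀ n ≥ c, g m n = f m n) : IsEvPoly g := by
  obtain ⟨p, c, hp⟩ := hf
  obtain ⟨d, hd⟩ := h
  refine ⟨p, max c d, fun m hm n hn => ?_⟩
  rw [hd m (le_of_max_le_right hm) n (le_of_max_le_right hn),
    hp m (le_of_max_le_left hm) n (le_of_max_le_left hn)]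

theorem substitute {f : ℕ → ℕ → ℚ} (hf : IsEvPoly f) (q : Fin 2 → MvPolynomial (Fin 2) ℚ)
    (u v : ℕ → ℕ → ℕ)
    (hu : ∀ m n, (u m n : ℚ) = MvPolynomial.eval ![(m : ℚ), n] (q 0))
    (hv : ∀ m n, (v m n : ℚ) = MvPolynomial.eval ![(m : ℚ), n] (q 1))
    (huv : ∀ d, ∃ e, ∀ m ≥ e, ∀ n ≥ e, d ≤ u m n ∧ d ≤ v m n) :
    IsEvPoly fun m n => f (u m n) (v m n) := by
  obtain ⟨p, c, hp⟩ := hf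
  obtain ⟨e, he⟩ := huv c
  refine ⟨MvPolynomial.bind₁ q p, e, fun m hm n hn => ?_⟩
  obtain ⟨h1, h2⟩ := he m hm n hn
  beta_reduce
  rw [hp _ h1 _ h2, MvPolynomial.eval_bind₁_eq]
  congr 2
  funext i
  fin_cases i
  · exact hu m n
  · exact hv m n

theorem swap {f : ℕ → ℕ → ℚ} (hf : IsEvPoly f) : IsEvPoly fun m n => f n m :=
  hf.substitute ![.X 1, .X 0] (fun _ n => n) (fun m _ => m) (by simp) (by simp)
    fun d => ⟨d, fun _ hm _ hn => ⟨hn, hm⟩⟩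

theorem shift_left {f : ℕ → ℕ → ℚ} (hf : IsEvPoly f) : IsEvPoly fun m n => f (m + 1) n :=
  hf.substitute ![.X 0 + 1, .X 1] (fun m _ => m + 1) (fun _ n => n) (by simp) (by simp)
    fun d => ⟨d, fun _ hm _ hn => ⟨Nat.le_succ_of_le hm, hn⟩⟩

theorem shift_right {f : ℕ → ℕ → ℚ} (hf : IsEvPoly f) : IsEvPoly fun m n => f m (n + 1) :=
  hf.swap.shift_left.swap

theorem slice {f : ℕ → ℕ → ℚ} (hf : IsEvPoly f) : ∃ c, ∀ k ≥ c, IsEvPoly fun _ n => f k n := by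
  obtain ⟨p, c, hp⟩ := hf
  refine ⟨c, fun k hk => ⟨MvPolynomial.bind₁ ![MvPolynomial.C (k : ℚ), .X 1] p, c,
    fun m _ n hn => ?_⟩⟩
  beta_reduce
  rw [hp k hk n hn, MvPolynomial.eval_bind₁_eq]
  congr 2
  funext i
  fin_cases i <;> simp

theorem exists_antidifference (p : MvPolynomial (Fin 2) ℚ) :
    ∃ q : MvPolynomial (Fin 2) ℚ, ∀ x y : ℚ,
      MvPolynomial.eval ![x + 1, y] q - MvPolynomial.eval ![x, y] q =
        MvPolynomial.eval ![x, y] p := by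
  induction p using MvPolynomial.induction_on' with
  | monomial u r =>
    refine ⟨MvPolynomial.C (r / (u 0 + 1)) *
      (Polynomial.aeval (MvPolynomial.X 0) (Polynomial.bernoulli (u 0 + 1))) *
        MvPolynomial.X 1 ^ u 1, fun x y => ?_⟩
    have h : ∀ z : ℚ, MvPolynomial.eval ![z, y] (Polynomial.aeval (MvPolynomial.X 0)
        (Polynomial.bernoulli (u 0 + 1))) = (Polynomial.bernoulli (u 0 + 1)).eval z := by
      intro z
      rw [← MvPolynomial.coe_aeval_eq_eval, RingHom.coe_coe, ← Polynomial.aeval_algHom_apply]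
      simp [Polynomial.aeval_def, Polynomial.eval₂_eq_eval_map]
    have hu : ((u 0 : ℚ) + 1) ≠ 0 := by positivity
    simp only [map_mul, MvPolynomial.eval_C, h, map_pow, MvPolynomial.eval_X,
      MvPolynomial.eval_monomial, add_comm x 1, Polynomial.bernoulli_eval_one_add,
      Finsupp.prod_fintype _ _ (fun i => pow_zero _), Fin.prod_univ_two]
    simp
    field_simp
    ring
  | add p q hp hq =>
    obtain ⟨p', hp'⟩ := hp
    obtain ⟨q', hq'⟩ := hq
    refine ⟨p' + q', fun x y => ?_⟩
    rw [map_add, map_add, map_add, ← hp', ← hq']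
    ring

theorem of_difference_left {f : ℕ → ℕ → ℚ} (hf : IsEvPoly fun m n => f (m + 1) n - f m n)
    (h : ∃ c, ∀ k ≥ c, IsEvPoly fun _ n => f k n) : IsEvPoly f := by
  obtain ⟨p, c, hp⟩ := hf
  obtain ⟨d, hd⟩ := h
  obtain ⟨q, hq⟩ := exists_antidifference p
  have hQ : IsEvPoly fun m n => MvPolynomial.eval ![(m : ℚ), n] q := ⟨q, 0, fun _ _ _ _ => rfl⟩
  obtain ⟨e, he⟩ := hQ.slice
  let k := max (max c d) e
  refine ((hQ.add (hd k (by omega))).sub (he k (by omega))).congr ⟨k, fun m hm n hn => ?_⟩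
  induction m, hm using Nat.le_induction with
  | base => ring
  | succ m hm ih =>
    have h1 := hp m (by omega) n (by omega)
    have h2 := hq m n
    push_cast at h1 h2 ⊢
    linarith

theorem of_differences {f : ℕ → ℕ → ℚ} (h₁ : IsEvPoly fun m n => f (m + 1) n - f m n)
    (h₂ : IsEvPoly fun m n => f m (n + 1) - f m n) : IsEvPoly f := by
  refine of_difference_left h₁ ?_
  obtain ⟨c, hc⟩ := h₂.slice
  refine ⟨c, fun k hk => ?_⟩
  have : IsEvPoly fun m (_ : ℕ) => f k m :=
    of_difference_left (hc k hk).swap ⟨0, fun l _ => const (f k l)⟩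
  exact this.swap

end IsEvPoly

/-- `g` is eventually finite and given by a polynomial. -/
def IsEvPolyLength (g : ℕ → ℕ → ℕ∞) : Prop :=
  (∃ c, ∀ m ≥ c, ∀ n ≥ c, g m n ≠ ⊤) ∧ IsEvPoly fun m n => ((g m n).toNat : ℚ)

theorem ENat.toNat_sub_of_add_eq_add {a b c d : ℕ∞} (h : a + b = c + d) (ha : a ≠ ⊤) (hb : b ≠ ⊤)
    (hc : c ≠ ⊤) (hd : d ≠ ⊤) : (c.toNat : ℚ) - a.toNat = b.toNat - d.toNat := by
  lift a to ℕ using ha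
  lift b to ℕ using hb
  lift c to ℕ using hc
  lift d to ℕ using hd
  have : a + b = c + d := by exact_mod_cast h
  have : (a : ℚ) + b = c + d := by exact_mod_cast this
  simp only [ENat.toNat_natCast]
  linarith

theorem isEvPoly_difference_right {g b d : ℕ → ℕ → ℕ∞} (hg : ∃ c, ∀ m ≥ c, ∀ n ≥ c, g m n ≠ ⊤)
    (hb : IsEvPolyLength b) (hd : IsEvPolyLength d)
    (h : ∀ m n, g m n + b m (n + 1) = g m (n + 1) + d m n) :
    IsEvPoly fun m n => ((g m (n + 1)).toNat : ℚ) - (g m n).toNat := by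
  obtain ⟨c, hc⟩ := hg
  obtain ⟨⟨c', hc'⟩, hb⟩ := hb
  obtain ⟨⟨c'', hc''⟩, hd⟩ := hd
  refine (hb.shift_right.sub hd).congr ⟨max (max c c') c'', fun m hm n hn => ?_⟩
  exact ENat.toNat_sub_of_add_eq_add (h m n) (hc _ (by omega) _ (by omega))
    (hc' _ (by omega) _ (by omega)) (hc _ (by omega) _ (by omega)) (hc'' _ (by omega) _ (by omega))

theorem isEvPoly_difference_left {g b d : ℕ → ℕ → ℕ∞} (hg : ∃ c, ∀ m ≥ c, ∀ n ≥ c, g m n ≠ ⊤)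
    (hb : IsEvPolyLength b) (hd : IsEvPolyLength d)
    (h : ∀ m n, g m n + b (m + 1) n = g (m + 1) n + d m n) :
    IsEvPoly fun m n => ((g (m + 1) n).toNat : ℚ) - (g m n).toNat := by
  obtain ⟨c, hc⟩ := hg
  obtain ⟨⟨c', hc'⟩, hb⟩ := hb
  obtain ⟨⟨c'', hc''⟩, hd⟩ := hd
  refine (hb.shift_left.sub hd).congr ⟨max (max c c') c'', fun m hm n hn => ?_⟩
  exact ENat.toNat_sub_of_add_eq_add (h m n) (hc _ (by omega) _ (by omega))
    (hc' _ (by omega) _ (by omega)) (hc _ (by omega) _ (by omega)) (hc'' _ (by omega) _ (by omega))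

namespace GradedOp

variable {R : Type} [CommRing R] {a : ℕ} {X : GradedOp R a} {J : Ideal R}

namespace IsFiltration

variable {U V : ℕ → ∀ n, Submodule R (X.carrier n)}

theorem inf (hU : X.IsFiltration J U) (hV : X.IsFiltration J V) :
    X.IsFiltration J fun m n => U m n ⊓ V m n where
  stable m k n :=
    le_inf (inf_le_left.trans (hU.stable m k n)) (inf_le_right.trans (hV.stable m k n))
  anti m n := inf_le_inf (hU.anti m n) (hV.anti m n)
  smul_le m n := le_inf ((Submodule.smul_mono le_rfl inf_le_left).trans (hU.smul_le m n))
    ((Submodule.smul_mono le_rfl inf_le_right).trans (hV.smul_le m n))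

theorem sup (hU : X.IsFiltration J U) (hV : X.IsFiltration J V) :
    X.IsFiltration J fun m n => U m n ⊔ V m n where
  stable m k n := sup_le ((hU.stable m k n).trans (Submodule.comap_mono le_sup_left))
    ((hV.stable m k n).trans (Submodule.comap_mono le_sup_right))
  anti m n := sup_le_sup (hU.anti m n) (hV.anti m n)
  smul_le m n := by
    rw [Submodule.smul_sup]
    exact sup_le_sup (hU.smul_le m n) (hV.smul_le m n)

theorem smul_mem (hU : X.IsFiltration J U) {r : R} (hr : r ∈ J) {m n : ℕ} {v : X.carrier n}
    (hv : v ∈ U m n) : r • v ∈ U (m + 1) n :=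
  hU.smul_le m n (Submodule.smul_mem_smul hr hv)

theorem comap_op (hV : X.IsFiltration J V) (k : Fin a) :
    X.IsFiltration J fun m n => (V m (n + 1)).comap (X.op k n) where
  stable m l n v hv := by
    simp only [Submodule.mem_comap] at hv ⊢
    rw [X.comm k l]
    exact hV.stable m l _ hv
  anti m n := Submodule.comap_mono (hV.anti m (n + 1))
  smul_le m n := Submodule.smul_le.2 fun r hr v hv => by
    simp only [Submodule.mem_comap, map_smul] at hv ⊢
    exact hV.smul_mem hr hv

/-- The images of a family under the operator `X.op k`. -/
def mapOp (k : Fin a) (U : ∀ n, Submodule R (X.carrier n)) : ∀ n, Submodule R (X.carrier n)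
  | 0 => ⊥
  | n + 1 => (U n).map (X.op k n)

theorem mapOp_filtration (hU : X.IsFiltration J U) (k : Fin a) :
    X.IsFiltration J fun m => mapOp k (U m) where
  stable m l n := by
    rcases n with _ | n
    · exact bot_le
    · refine Submodule.map_le_iff_le_comap.2 fun v hv => ?_
      exact ⟨X.op l n v, hU.stable m l n hv, X.comm k l n v⟩
  anti m n := by
    rcases n with _ | n
    · exact le_rfl
    · exact Submodule.map_mono (hU.anti m n)
  smul_le m n := by
    rcases n with _ | n
    · exact (Submodule.smul_bot J).le
    · change J • (U m n).map (X.op k n) ≤ (U (m + 1) n).map (X.op k n)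
      rw [← Submodule.map_smul'']
      exact Submodule.map_mono (hU.smul_le m n)

theorem comap_lsmul (hV : X.IsFiltration J V) (r : R) :
    X.IsFiltration J fun m n => (V (m + 1) n).comap (LinearMap.lsmul R _ r) where
  stable m l n v hv := by
    simp only [Submodule.mem_comap, LinearMap.lsmul_apply, ← map_smul] at hv ⊢
    exact hV.stable (m + 1) l _ hv
  anti m n := Submodule.comap_mono (hV.anti (m + 1) n)
  smul_le m n := Submodule.smul_le.2 fun s hs v hv => by
    simp only [Submodule.mem_comap, LinearMap.lsmul_apply] at hv ⊢
    rw [smul_comm]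
    exact hV.smul_mem hs hv

theorem map_lsmul (hU : X.IsFiltration J U) (r : R) :
    X.IsFiltration J fun m n => (U (m - 1) n).map (LinearMap.lsmul R _ r) where
  stable m l n := Submodule.map_le_iff_le_comap.2 fun v hv =>
    ⟨X.op l n v, hU.stable _ l n hv, by simp⟩
  anti m n := Submodule.map_mono <| by
    rcases m with _ | m
    · exact le_rfl
    · exact hU.anti m n
  smul_le m n := by
    rw [← Submodule.map_smul'']
    refine Submodule.map_mono ((hU.smul_le _ n).trans ?_)
    rcases m with _ | m
    · exact hU.anti 0 n
    · exact le_rfl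

end IsFiltration

theorem isEvPolyLength_relLen_of_killed [IsNoetherianRing R] (hX : X.FG) {b : ℕ} {y : Fin b → R}
    (hy : Ideal.span (Set.range y) = J) (s : Finset (Fin a)) (t : Finset (Fin b))
    {U V : ℕ → ∀ n, Submodule R (X.carrier n)} (hU : X.IsFiltration J U)
    (hV : X.IsFiltration J V) (hVU : ∀ m n, V m n ≤ U m n) (hle : ∀ m n, U m n ≤ J ^ m • ⊤)
    (hfin : ∃ c, ∀ m ≥ c, ∀ n ≥ c, relLen (V m n) (U m n) ≠ ⊤)
    (hs : ∀ k ∉ s, ∀ m n, (U m n).map (X.op k n) ≤ V m (n + 1))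
    (ht : ∀ l ∉ t, ∀ m n, (U m n).map (LinearMap.lsmul R _ (y l)) ≤ V (m + 1) n) :
    IsEvPolyLength fun m n => relLen (V m n) (U m n) := by
  induction hN : s.card + t.card using Nat.strong_induction_on generalizing s t U V with
  | _ N ih =>
  subst hN
  have of_zero : (∃ c, ∀ m ≥ c, ∀ n ≥ c, U m n ≤ V m n) →
      IsEvPolyLength fun m n => relLen (V m n) (U m n) := by
    rintro ⟨c, hc⟩
    refine ⟨hfin, (IsEvPoly.const 0).congr ⟨c, fun m hm n hn => ?_⟩⟩
    beta_reduce
    rw [relLen_eq_zero_of_le (hc m hm n hn)]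
    simp
  rcases s.eq_empty_or_nonempty with rfl | ⟨k, hk⟩
  · obtain ⟨c, hc⟩ := hX.exists_le_of_map_le hU hV hle fun m n k => hs k (by simp) m n
    exact of_zero ⟨c, fun m _ n hn => hc n hn m⟩
  rcases t.eq_empty_or_nonempty with rfl | ⟨l, hl⟩
  · obtain ⟨c, hc⟩ := hX.exists_le_of_smul_le (V := V) hU hle fun m n => by
      rw [Submodule.smul_le]
      intro r hr v hv
      suffices J ≤ Submodule.colon (V (m + 1) n) (U m n : Set (X.carrier n)) from
        Submodule.mem_colon.1 (this hr) v hv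
      rw [← hy, Ideal.span_le]
      rintro _ ⟨l, rfl⟩
      exact Submodule.mem_colon.2 fun v hv => ht l (by simp) m n ⟨v, hv, rfl⟩
    exact of_zero ⟨c, fun m hm n _ => hc m hm n⟩
  have hyl : y l ∈ J := hy ▸ Ideal.subset_span ⟨l, rfl⟩
  have hUk : ∀ m n, (U m n).map (X.op k n) ≤ U m (n + 1) := fun m n =>
    Submodule.map_le_iff_le_comap.2 (hU.stable m k n)
  have hUl : ∀ m n, (U m n).map (LinearMap.lsmul R _ (y l)) ≤ U (m + 1) n := fun m n =>
    Submodule.map_le_iff_le_comap.2 fun v hv => hU.smul_mem hyl hv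
  have hfin_sub : ∀ {W : ℕ → ∀ n, Submodule R (X.carrier n)}, (∀ m n, V m n ≤ W m n) →
      (∀ m n, W m n ≤ U m n) → ∃ c, ∀ m ≥ c, ∀ n ≥ c, relLen (V m n) (W m n) ≠ ⊤ := by
    intro W h₁ h₂
    obtain ⟨c, hc⟩ := hfin
    exact ⟨c, fun m hm n hn =>
      ne_top_of_le_ne_top (hc m hm n hn) (relLen_mono_right (h₁ m n) (h₂ m n))⟩
  have hfin_quot : ∀ {W : ℕ → ∀ n, Submodule R (X.carrier n)}, (∀ m n, V m n ≤ W m n) →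
      (∀ m n, W m n ≤ U m n) → ∃ c, ∀ m ≥ c, ∀ n ≥ c, relLen (W m n) (U m n) ≠ ⊤ := by
    intro W h₁ h₂
    obtain ⟨c, hc⟩ := hfin
    exact ⟨c, fun m hm n hn =>
      ne_top_of_le_ne_top (hc m hm n hn) (relLen_anti_left (h₁ m n) (h₂ m n))⟩
  have hcs : (s.erase k).card + t.card < s.card + t.card := by
    have := Finset.card_erase_lt_of_mem hk
    omega
  have hct : s.card + (t.erase l).card < s.card + t.card := by
    have := Finset.card_erase_lt_of_mem hl
    omega
  have hVk : ∀ m n, V m n ≤ U m n ⊓ (V m (n + 1)).comap (X.op k n) := fun m n =>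
    le_inf (hVU m n) (hV.stable m k n)
  have hVl : ∀ m n, V m n ≤ U m n ⊓ (V (m + 1) n).comap (LinearMap.lsmul R _ (y l)) :=
    fun m n => le_inf (hVU m n) fun v hv => hV.smul_mem hyl hv
  have hCk : ∀ m n, V m n ⊔ IsFiltration.mapOp k (U m) n ≤ U m n := fun m n =>
      sup_le (hVU m n) <| by
    rcases n with _ | n
    exacts [bot_le, hUk m n]
  have hCl : ∀ m n, V m n ⊔ (U (m - 1) n).map (LinearMap.lsmul R _ (y l)) ≤ U m n :=
    fun m n => sup_le (hVU m n) <| by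
      rcases m with _ | m
      exacts [(hUl 0 n).trans (hU.anti 0 n), hUl m n]
  have kerk := ih _ hcs (s.erase k) t (hU.inf (hV.comap_op k)) hV hVk
    (fun m n => inf_le_left.trans (hle m n)) (hfin_sub hVk fun m n => inf_le_left)
    (fun k' hk' m n => by
      rcases eq_or_ne k' k with rfl | h
      · exact Submodule.map_le_iff_le_comap.2 inf_le_right
      · exact (Submodule.map_mono inf_le_left).trans
          (hs k' (fun h' => hk' (Finset.mem_erase.2 ⟨h, h'⟩)) m n))
    (fun l' hl' m n => (Submodule.map_mono inf_le_left).trans (ht l' hl' m n)) rfl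
  have cokk := ih _ hcs (s.erase k) t hU (hV.sup (hU.mapOp_filtration k)) hCk hle
    (hfin_quot (fun m n => le_sup_left) hCk)
    (fun k' hk' m n => by
      rcases eq_or_ne k' k with rfl | h
      · exact le_sup_right
      · exact le_sup_of_le_left (hs k' (fun h' => hk' (Finset.mem_erase.2 ⟨h, h'⟩)) m n))
    (fun l' hl' m n => le_sup_of_le_left (ht l' hl' m n)) rfl
  have kerl := ih _ hct s (t.erase l) (hU.inf (hV.comap_lsmul (y l))) hV hVl
    (fun m n => inf_le_left.trans (hle m n)) (hfin_sub hVl fun m n => inf_le_left)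
    (fun k' hk' m n => (Submodule.map_mono inf_le_left).trans (hs k' hk' m n))
    (fun l' hl' m n => by
      rcases eq_or_ne l' l with rfl | h
      · exact Submodule.map_le_iff_le_comap.2 inf_le_right
      · exact (Submodule.map_mono inf_le_left).trans
          (ht l' (fun h' => hl' (Finset.mem_erase.2 ⟨h, h'⟩)) m n)) rfl
  have cokl := ih _ hct s (t.erase l) hU (hV.sup (hU.map_lsmul (y l))) hCl hle
    (hfin_quot (fun m n => le_sup_left) hCl)
    (fun k' hk' m n => le_sup_of_le_left (hs k' hk' m n))
    (fun l' hl' m n => by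
      rcases eq_or_ne l' l with rfl | h
      · exact le_sup_right
      · exact le_sup_of_le_left (ht l' (fun h' => hl' (Finset.mem_erase.2 ⟨h, h'⟩)) m n)) rfl
  refine ⟨hfin, IsEvPoly.of_differences (isEvPoly_difference_left hfin cokl kerl fun m n => ?_)
    (isEvPoly_difference_right hfin cokk kerk fun m n => ?_)⟩
  · exact relLen_add_cokernel _ (hVU m n) (hVU (m + 1) n) (fun v hv => hV.smul_mem hyl hv)
      (fun v hv => hU.smul_mem hyl hv)
  · exact relLen_add_cokernel _ (hVU m n) (hVU m (n + 1)) (hV.stable m k n) (hU.stable m k n)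

/-- The relative length of two filtrations contained in the `J`-adic one is eventually
polynomial. -/
theorem isEvPolyLength_relLen [IsNoetherianRing R] (hX : X.FG)
    {U V : ℕ → ∀ n, Submodule R (X.carrier n)} (hU : X.IsFiltration J U)
    (hV : X.IsFiltration J V) (hVU : ∀ m n, V m n ≤ U m n) (hle : ∀ m n, U m n ≤ J ^ m • ⊤)
    (hfin : ∃ c, ∀ m ≥ c, ∀ n ≥ c, relLen (V m n) (U m n) ≠ ⊤) :
    IsEvPolyLength fun m n => relLen (V m n) (U m n) := by
  obtain ⟨b, y, hy⟩ := Submodule.fg_iff_exists_fin_generating_family.1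
    (IsNoetherian.noetherian J)
  exact isEvPolyLength_relLen_of_killed hX hy Finset.univ Finset.univ hU hV hVU hle hfin
    (by simp) (by simp)

end GradedOp

namespace GradedOp

variable {R : Type} [CommRing R] {a : ℕ} {A B : GradedOp R a} {J : Ideal R}

theorem isFiltration_pow_smul_top (A : GradedOp R a) (J : Ideal R) :
    A.IsFiltration J fun m n => J ^ m • (⊤ : Submodule R (A.carrier n)) where
  stable m := Stable.ideal_smul (U := fun _ => ⊤) (fun _ _ _ _ => trivial) (J ^ m)
  anti m n := Submodule.smul_mono (Ideal.pow_le_pow_right (Nat.le_succ m)) le_rfl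
  smul_le m n := by rw [pow_succ', mul_smul]

namespace IsFiltration

theorem shift {U : ℕ → ∀ n, Submodule R (A.carrier n)} (hU : A.IsFiltration J U) :
    A.IsFiltration J fun m => U (m + 1) where
  stable m := hU.stable (m + 1)
  anti m := hU.anti (m + 1)
  smul_le m := hU.smul_le (m + 1)

theorem map {U : ℕ → ∀ n, Submodule R (A.carrier n)} (hU : A.IsFiltration J U)
    {φ : ∀ n, A.carrier n →ₗ[R] B.carrier n}
    (hφ : ∀ k n v, φ (n + 1) (A.op k n v) = B.op k n (φ n v)) :
    B.IsFiltration J fun m n => (U m n).map (φ n) where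
  stable m k n := Submodule.map_le_iff_le_comap.2 fun v hv =>
    ⟨A.op k n v, hU.stable m k n hv, hφ k n v⟩
  anti m n := Submodule.map_mono (hU.anti m n)
  smul_le m n := by
    rw [← Submodule.map_smul'']
    exact Submodule.map_mono (hU.smul_le m n)

theorem comap {V : ℕ → ∀ n, Submodule R (B.carrier n)} (hV : B.IsFiltration J V)
    {φ : ∀ n, A.carrier n →ₗ[R] B.carrier n}
    (hφ : ∀ k n v, φ (n + 1) (A.op k n v) = B.op k n (φ n v)) :
    A.IsFiltration J fun m n => (V m n).comap (φ n) where
  stable m k n v hv := by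
    rw [Submodule.mem_comap, Submodule.mem_comap, hφ]
    exact hV.stable m k n hv
  anti m n := Submodule.comap_mono (hV.anti m n)
  smul_le m n := Submodule.smul_le.2 fun r hr v hv => by
    rw [Submodule.mem_comap, map_smul]
    exact hV.smul_mem hr hv

theorem const {U : ∀ n, Submodule R (A.carrier n)} (hU : A.Stable U) :
    A.IsFiltration J fun _ => U where
  stable _ := hU
  anti _ _ := le_rfl
  smul_le _ _ := Submodule.smul_le_right

end IsFiltration

/-- The length of the kernel of `A n ⧸ J ^ m A n → B n ⧸ J ^ m B n` is eventually polynomial. -/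
theorem isEvPolyLength_relLen_comap [IsNoetherianRing R] (hA : A.FG) (hB : B.FG)
    {φ : ∀ n, A.carrier n →ₗ[R] B.carrier n}
    (hφ : ∀ k n v, φ (n + 1) (A.op k n v) = B.op k n (φ n v))
    (hfin : ∃ c, ∀ m ≥ c, ∀ n ≥ c, relLen (J ^ m • ⊤) (Submodule.comap (φ n) (J ^ m • ⊤)) ≠ ⊤) :
    IsEvPolyLength fun m n => relLen (J ^ m • ⊤) (Submodule.comap (φ n) (J ^ m • ⊤)) := by
  obtain ⟨c, hc⟩ := hfin
  have hFA := A.isFiltration_pow_smul_top J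
  have hFB := B.isFiltration_pow_smul_top J
  have hFφ := hFB.comap hφ
  have hle : ∀ m n, J ^ m • (⊤ : Submodule R (A.carrier n)) ≤
      Submodule.comap (φ n) (J ^ m • ⊤) := by
    intro m n
    rw [← Submodule.map_le_iff_le_comap, Submodule.map_smul'']
    exact Submodule.smul_mono le_rfl le_top
  have hker : IsEvPolyLength fun m n => relLen (J ^ (m + 1) • ⊤)
      (J ^ m • ⊤ ⊓ Submodule.comap (φ n) (J ^ (m + 1) • ⊤)) :=
    isEvPolyLength_relLen hA (hFA.inf hFφ.shift) hFA.shift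
      (fun m n => le_inf (hFA.anti m n) (hle (m + 1) n)) (fun m n => inf_le_left)
      ⟨c, fun m hm n hn => ne_top_of_le_ne_top (hc (m + 1) (by omega) n hn)
        (relLen_mono_right (le_inf (hFA.anti m n) (hle (m + 1) n)) inf_le_right)⟩
  have hsup : ∀ m n, J ^ m • (⊤ : Submodule R (A.carrier n)) ⊔
      Submodule.comap (φ n) (J ^ (m + 1) • ⊤) ≤ Submodule.comap (φ n) (J ^ m • ⊤) :=
    fun m n => sup_le (hle m n) (hFφ.anti m n)
  have hmap : ∀ m n, relLen (J ^ m • ⊤ ⊔ Submodule.comap (φ n) (J ^ (m + 1) • ⊤))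
      (Submodule.comap (φ n) (J ^ m • ⊤)) =
        relLen (Submodule.map (φ n) (J ^ m • ⊤ ⊔ Submodule.comap (φ n) (J ^ (m + 1) • ⊤)))
          (Submodule.map (φ n) (Submodule.comap (φ n) (J ^ m • ⊤))) := fun m n =>
    (relLen_map (φ n) (hsup m n)
      (le_sup_of_le_right (Submodule.comap_mono (f := φ n) bot_le))).symm
  have hcok : IsEvPolyLength fun m n => relLen (J ^ m • ⊤ ⊔ Submodule.comap (φ n) (J ^ (m + 1) • ⊤))
      (Submodule.comap (φ n) (J ^ m • ⊤)) := by
    simp only [hmap]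
    refine isEvPolyLength_relLen hB (hFφ.map hφ) ((hFA.sup hFφ.shift).map hφ)
      (fun m n => Submodule.map_mono (hsup m n)) (fun m n => Submodule.map_comap_le _ _)
      ⟨c, fun m hm n hn => ?_⟩
    rw [← hmap]
    exact ne_top_of_le_ne_top (hc m hm n hn) (relLen_anti_left le_sup_left (hsup m n))
  refine ⟨⟨c, hc⟩, IsEvPoly.of_difference_left ?_ ⟨c, fun k hk => ?_⟩⟩
  · obtain ⟨⟨c₁, hc₁⟩, hker⟩ := hker
    obtain ⟨⟨c₂, hc₂⟩, hcok⟩ := hcok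
    refine (hker.sub hcok).congr ⟨max c (max c₁ c₂), fun m hm n hn => ?_⟩
    refine ENat.toNat_sub_of_add_eq_add ?_ (hc m (by omega) n (by omega))
      (hc₁ m (by omega) n (by omega)) (hc (m + 1) (by omega) n (by omega))
      (hc₂ m (by omega) n (by omega))
    have := relLen_add_cokernel LinearMap.id (hle (m + 1) n) (hle m n) (hFA.anti m n)
      (hFφ.anti m n)
    rw [Submodule.map_id, Submodule.comap_id, inf_comm] at this
    exact this.symm
  · exact (isEvPolyLength_relLen (J := ⊤) hA (.const (hFφ.stable k)) (.const (hFA.stable k))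
      (fun _ n => hle k n) (fun m n => by
        rw [Ideal.top_pow, Submodule.top_smul]; exact le_top) ⟨c, fun m _ n hn => hc k hk n hn⟩).2

end GradedOp

namespace GradedOp

variable {R : Type} [CommRing R] {a : ℕ} (X : GradedOp R a)

variable {X} in
/-- The graded family given by a stable family of submodules. -/
def ofStable {U : ∀ n, Submodule R (X.carrier n)} (hU : X.Stable U) : GradedOp R a where
  carrier n := U n
  op k n := (X.op k n).restrict (hU k n)
  comm k l n v := Subtype.ext (X.comm k l n v)

variable {X} in
theorem ofStable_fg {U : ∀ n, Submodule R (X.carrier n)} (hU : X.Stable U)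
    (hfin : ∀ n, Module.Finite R (U n))
    (hgen : ∃ c, ∀ n ≥ c, U (n + 1) = ⨆ k, (U n).map (X.op k n)) :
    (ofStable hU).FG where
  finite := hfin
  generated := by
    obtain ⟨c, hc⟩ := hgen
    refine ⟨c, fun n hn => ?_⟩
    change ⨆ k, LinearMap.range ((X.op k n).restrict (hU k n)) = ⊤
    refine Submodule.map_injective_of_injective (U (n + 1)).injective_subtype ?_
    refine (Submodule.map_iSup _ _).trans ((?_ : _ = U (n + 1)).trans (by simp))
    refine (iSup_congr fun k => ?_).trans (hc n hn).symm
    rw [← LinearMap.range_comp]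
    change LinearMap.range ((X.op k n).comp (U n).subtype) = _
    rw [LinearMap.range_comp, Submodule.range_subtype]

variable {X} in
theorem FG.ofStable [IsNoetherianRing R] (hX : X.FG) {U : ∀ n, Submodule R (X.carrier n)}
    (hU : X.Stable U) : (ofStable hU).FG :=
  ofStable_fg hU
    (fun n => by
      have := hX.finite n
      infer_instance)
    (hX.exists_eq_iSup_map hU)

open TensorProduct

/-- The tensor product of a graded family with a module. -/
noncomputable def tensor (N : Type) [AddCommGroup N] [Module R N] : GradedOp R a where
  carrier n := X.carrier n ⊗[R] N
  op k n := (X.op k n).rTensor N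
  comm k l n v := by
    simp only [← LinearMap.comp_apply, ← LinearMap.rTensor_comp]
    congr 2
    exact LinearMap.ext (X.comm k l n)

variable {X} in
theorem FG.tensor (hX : X.FG) (N : Type) [AddCommGroup N] [Module R N] [Module.Finite R N] :
    (X.tensor N).FG where
  finite n := by
    have := hX.finite n
    exact inferInstanceAs (Module.Finite R (X.carrier n ⊗[R] N))
  generated := by
    obtain ⟨c, hc⟩ := hX.generated
    refine ⟨c, fun n hn => ?_⟩
    change ⨆ k, LinearMap.range ((X.op k n).rTensor N) = ⊤
    rw [eq_top_iff, ← TensorProduct.span_tmul_eq_top, Submodule.span_le]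
    rintro _ ⟨x, y, rfl⟩
    suffices ⊤ ≤ (⨆ k, LinearMap.range ((X.op k n).rTensor N)).comap
        ((TensorProduct.mk R _ N).flip y) from this (x := x) trivial
    rw [← hc n hn, iSup_le_iff]
    rintro k _ ⟨v, rfl⟩
    exact Submodule.mem_iSup_of_mem k ⟨v ⊗ₜ y, rfl⟩

variable {G : Type} (deg : G → ℕ)

/-- Monomials of degree `n` on generators in `G` of prescribed degrees. -/
abbrev Mon (a : ℕ) (n : ℕ) : Type := {p : G × (Fin a → ℕ) // deg p.1 + ∑ k, p.2 k = n}

/-- Multiplication of monomials by the variable `k`. -/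
def Mon.mul (k : Fin a) (n : ℕ) (p : Mon deg a n) : Mon deg a (n + 1) :=
  ⟨(p.1.1, p.1.2 + Pi.single k 1), by
    simp only [Pi.add_apply, Finset.sum_add_distrib, Finset.sum_pi_single', Finset.mem_univ,
      if_true]
    have := p.2
    omega⟩

theorem Mon.exists_mul {n : ℕ} (p : Mon deg a (n + 1)) (h : deg p.1.1 ≤ n) :
    ∃ k q, Mon.mul deg k n q = p := by
  obtain ⟨⟨g, α⟩, hp⟩ := p
  dsimp only at hp h
  obtain ⟨k, -, hk⟩ : ∃ k ∈ Finset.univ, α k ≠ 0 :=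
    Finset.exists_ne_zero_of_sum_ne_zero (by omega)
  have hα : α - Pi.single k 1 + Pi.single k 1 = α := by
    funext i
    rcases eq_or_ne i k with rfl | hi
    · simp; omega
    · simp [hi]
  refine ⟨k, ⟨(g, α - Pi.single k 1), ?_⟩, Subtype.ext (Prod.ext rfl hα)⟩
  have : ∑ i, α i = ∑ i, (α - Pi.single k 1 : Fin a → ℕ) i + 1 := by
    conv_lhs => rw [← hα]
    simp [Finset.sum_add_distrib]
  dsimp only
  omega

instance Mon.finite [Finite G] (n : ℕ) : Finite (Mon deg a n) := by
  refine Finite.of_injective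
    (fun p : Mon deg a n => (p.1.1, fun k => (⟨p.1.2 k, ?_⟩ : Fin (n + 1)))) ?_
  · have := Finset.single_le_sum (f := p.1.2) (fun i _ => Nat.zero_le _) (Finset.mem_univ k)
    have := p.2
    omega
  · intro p q h
    simp only [Prod.mk.injEq, funext_iff, Fin.mk.injEq] at h
    exact Subtype.ext (Prod.ext h.1 (funext h.2))

/-- The free graded family on generators of prescribed degrees. -/
noncomputable def free (R : Type) [CommRing R] (a : ℕ) {G : Type} (deg : G → ℕ) :
    GradedOp R a where
  carrier n := Mon deg a n →₀ R
  op k n := Finsupp.lmapDomain R R (Mon.mul deg k n)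
  comm k l n v := by
    simp only [Finsupp.lmapDomain_apply, ← Finsupp.mapDomain_comp]
    congr 1
    funext p
    exact Subtype.ext (Prod.ext rfl (add_right_comm _ _ _))

theorem free_fg [Finite G] : (free R a deg).FG where
  finite n := inferInstanceAs (Module.Finite R (Mon deg a n →₀ R))
  generated := by
    obtain ⟨c, hc⟩ := (Set.finite_range deg).bddAbove
    refine ⟨c, fun n hn => ?_⟩
    change ⨆ k, LinearMap.range (Finsupp.lmapDomain R R (Mon.mul deg k n)) = ⊤
    rw [eq_top_iff]
    intro f _
    induction f using Finsupp.induction_linear with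
    | zero => exact zero_mem _
    | add f g hf hg => exact add_mem (hf trivial) (hg trivial)
    | single p r =>
      obtain ⟨k, q, rfl⟩ := Mon.exists_mul deg p ((hc ⟨_, rfl⟩).trans hn)
      exact Submodule.mem_iSup_of_mem k ⟨Finsupp.single q r, by simp⟩

/-- The value of a monomial, given the images of the generators. -/
noncomputable def monVal (e : ∀ g, X.carrier (deg g)) (n : ℕ) (p : Mon deg a n) : X.carrier n :=
  ((∏ k, X.gen k ^ p.1.2 k) • DirectSum.lof R ℕ X.carrier _ (e p.1.1)) n

theorem monVal_mul (e : ∀ g, X.carrier (deg g)) (k : Fin a) (n : ℕ) (p : Mon deg a n) :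
    X.monVal deg e (n + 1) (Mon.mul deg k n p) = X.op k n (X.monVal deg e n p) := by
  rw [monVal, monVal, ← totalOp_apply_succ, ← gen_smul, smul_smul]
  congr 2
  simp only [Mon.mul, Pi.add_apply, pow_add, Finset.prod_mul_distrib]
  rw [mul_comm, Finset.prod_eq_single k (fun i _ hi => by simp [hi]) (by simp)]
  simp

/-- The map from the free graded family determined by the images of the generators. -/
noncomputable def freeLift (e : ∀ g, X.carrier (deg g)) (n : ℕ) :
    (free R a deg).carrier n →ₗ[R] X.carrier n :=
  Finsupp.linearCombination R (X.monVal deg e n)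

theorem freeLift_op (e : ∀ g, X.carrier (deg g)) (k : Fin a) (n : ℕ)
    (v : (free R a deg).carrier n) :
    X.freeLift deg e (n + 1) ((free R a deg).op k n v) = X.op k n (X.freeLift deg e n v) := by
  have key : ∀ w : Mon deg a n →₀ R, Finsupp.linearCombination R (X.monVal deg e (n + 1))
      (Finsupp.mapDomain (Mon.mul deg k n) w) =
      X.op k n (Finsupp.linearCombination R (X.monVal deg e n) w) := by
    intro w
    rw [Finsupp.linearCombination_mapDomain, Finsupp.apply_linearCombination]
    congr 2
    funext p
    exact X.monVal_mul deg e k n p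
  exact key v

variable {X} in
/-- A finitely generated graded family is a quotient of a free one. -/
theorem FG.exists_free_cover (hX : X.FG) :
    ∃ (F : GradedOp R a) (π : ∀ n, F.carrier n →ₗ[R] X.carrier n),
    F.FG ∧ (∀ n, Module.Free R (F.carrier n)) ∧
      (∀ k n v, π (n + 1) (F.op k n v) = X.op k n (π n v)) ∧
      ∀ n, Function.Surjective (π n) := by
  obtain ⟨c, hc⟩ := hX.generated
  choose s hs using fun n => (hX.finite n).fg_top
  let G := Σ d : Fin (c + 1), s d
  let deg : G → ℕ := fun g => g.1
  let e : ∀ g, X.carrier (deg g) := fun g => g.2.1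
  refine ⟨free R a deg, X.freeLift deg e, free_fg deg,
    fun n => inferInstanceAs (Module.Free R (Mon deg a n →₀ R)), X.freeLift_op deg e, fun n => ?_⟩
  rw [← LinearMap.range_eq_top, eq_top_iff]
  have base : ∀ n ≤ c, ⊤ ≤ LinearMap.range (X.freeLift deg e n) := by
    intro n h
    rw [← hs n, Submodule.span_le]
    intro v hv
    let g : G := ⟨⟨n, Nat.lt_succ_of_le h⟩, ⟨v, hv⟩⟩
    refine ⟨Finsupp.single (⟨(g, 0), by simp [deg, g]⟩ : Mon deg a n) 1, ?_⟩
    refine (Finsupp.linearCombination_single R 1 _).trans ?_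
    simp only [monVal, one_smul, Pi.zero_apply, pow_zero, Finset.prod_const_one]
    exact DirectSum.lof_apply R n v
  induction n with
  | zero => exact base 0 (Nat.zero_le c)
  | succ n ih =>
    rcases Nat.lt_or_ge n c with h | h
    · exact base (n + 1) h
    · rw [← hc n h, iSup_le_iff]
      rintro k _ ⟨v, rfl⟩
      obtain ⟨w, rfl⟩ := ih (x := v) trivial
      exact ⟨_, X.freeLift_op deg e k n w⟩

end GradedOp

section TorLength

open CategoryTheory MonoidalCategory Limits

variable {R : Type} [CommRing R]

namespace CategoryTheory.ProjectiveResolution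

variable {Y : ModuleCat.{0} R} (P : ProjectiveResolution Y)

/-- The complex obtained by tensoring a projective resolution with `X`. -/
noncomputable abbrev tensorComplex (X : ModuleCat.{0} R) : ChainComplex (ModuleCat.{0} R) ℕ :=
  (((tensoringLeft _).obj X).mapHomologicalComplex _).obj P.complex

/-- Functoriality of `tensorComplex`. -/
noncomputable abbrev tensorComplexMap {X X' : ModuleCat.{0} R} (f : X ⟶ X') :
    P.tensorComplex X ⟶ P.tensorComplex X' :=
  (NatTrans.mapHomologicalComplex ((tensoringLeft _).map f) _).app P.complex

/-- The short complex of complexes obtained by tensoring with a projective resolution. -/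
noncomputable abbrev tensorShortComplex (S : ShortComplex (ModuleCat.{0} R)) :
    ShortComplex (ChainComplex (ModuleCat.{0} R) ℕ) :=
  ShortComplex.mk (P.tensorComplexMap S.f) (P.tensorComplexMap S.g) (by
    ext1 i
    change S.f ▷ _ ≫ S.g ▷ _ = 0
    rw [← comp_whiskerRight, S.zero, MonoidalPreadditive.zero_whiskerRight])

theorem tensorShortComplex_shortExact {S : ShortComplex (ModuleCat.{0} R)} (hS : S.ShortExact) :
    (P.tensorShortComplex S).ShortExact := by
  refine HomologicalComplex.shortExact_of_degreewise_shortExact _ fun i => ?_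
  have : Module.Projective R (P.complex.X i) :=
    (IsProjective.iff_projective _).2 (P.projective i)
  have : Module.Flat R (P.complex.X i) := inferInstance
  exact hS.map_of_exact (tensorRight (P.complex.X i))

theorem isZero_homology_tensorComplex (F : ModuleCat.{0} R) [Module.Flat R F] (n : ℕ) :
    IsZero ((P.tensorComplex F).homology (n + 1)) := by
  rw [← HomologicalComplex.exactAt_iff_isZero_homology]
  exact (P.complex_exactAt_succ n).map (tensorLeft F)

/-- The zeroth homology of `tensorComplex` is the tensor product. -/
noncomputable def homologyZeroTensorIso (X : ModuleCat.{0} R) :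
    (P.tensorComplex X).homology 0 ≅ X ⊗ Y :=
  asIso ((P.tensorComplex X).homologyι 0) ≪≫
    asIso (P.fromLeftDerivedZero' ((tensoringLeft _).obj X))

theorem homologyZeroTensorIso_naturality {X X' : ModuleCat.{0} R} (f : X ⟶ X') :
    HomologicalComplex.homologyMap (P.tensorComplexMap f) 0 ≫ (P.homologyZeroTensorIso X').hom =
      (P.homologyZeroTensorIso X).hom ≫ f ▷ Y := by
  have h : HomologicalComplex.opcyclesMap (P.tensorComplexMap f) 0 ≫
      P.fromLeftDerivedZero' ((tensoringLeft _).obj X') =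
        P.fromLeftDerivedZero' ((tensoringLeft _).obj X) ≫ f ▷ Y := by
    rw [← cancel_epi (HomologicalComplex.pOpcycles _ _),
      HomologicalComplex.p_opcyclesMap_assoc, pOpcycles_comp_fromLeftDerivedZero',
      pOpcycles_comp_fromLeftDerivedZero'_assoc]
    exact (whisker_exchange f (P.π.f 0)).symm
  simp only [homologyZeroTensorIso, Iso.trans_hom, asIso_hom, Category.assoc]
  rw [HomologicalComplex.homologyι_naturality_assoc, h]

end CategoryTheory.ProjectiveResolution

theorem ModuleCat.length_eq_of_iso {A B : ModuleCat.{0} R} (e : A ≅ B) :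
    Module.length R A = Module.length R B :=
  e.toLinearEquiv.length_eq

/-- The length of `Tor i X Y`. -/
noncomputable def torLen (R : Type) [CommRing R] (i : ℕ) (X : Type) [AddCommGroup X] [Module R X]
    (Y : Type) [AddCommGroup Y] [Module R Y] : ℕ∞ :=
  Module.length R (((Tor (ModuleCat.{0} R) i).obj (ModuleCat.of R X)).obj (ModuleCat.of R Y))

section

variable {K F X Y : Type} [AddCommGroup K] [Module R K] [AddCommGroup F] [Module R F]
  [AddCommGroup X] [Module R X] [AddCommGroup Y] [Module R Y]

open scoped TensorProduct

theorem torLen_zero : torLen R 0 X Y = Module.length R (X ⊗[R] Y) :=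
  ModuleCat.length_eq_of_iso
    (((tensoringLeft (ModuleCat.{0} R)).obj (ModuleCat.of R X)).leftDerivedZeroIsoSelf.app
      (ModuleCat.of R Y))

variable {f : K →ₗ[R] F} {g : F →ₗ[R] X} [Module.Flat R F]

theorem torLen_succ_succ (hf : Function.Injective f) (hfg : Function.Exact f g)
    (hg : Function.Surjective g) (i : ℕ) : torLen R (i + 2) X Y = torLen R (i + 1) K Y := by
  let S : ShortComplex (ModuleCat.{0} R) :=
    ShortComplex.mk (ModuleCat.ofHom f) (ModuleCat.ofHom g)
      (ModuleCat.hom_ext hfg.linearMap_comp_eq_zero)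
  have hS : S.ShortExact :=
    { exact := (ShortComplex.ShortExact.moduleCat_exact_iff_function_exact _).2 hfg
      mono_f := (ModuleCat.mono_iff_injective _).2 hf
      epi_g := (ModuleCat.epi_iff_surjective _).2 hg }
  let P := projectiveResolution (ModuleCat.of R Y)
  have hP := P.tensorShortComplex_shortExact hS
  exact ModuleCat.length_eq_of_iso
    (P.isoLeftDerivedObj ((tensoringLeft _).obj (ModuleCat.of R X)) (i + 2) ≪≫
      hP.δIso (i + 2) (i + 1) (by simp)
        (P.isZero_homology_tensorComplex (ModuleCat.of R F) (i + 1))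
        (P.isZero_homology_tensorComplex (ModuleCat.of R F) i) ≪≫
      (P.isoLeftDerivedObj ((tensoringLeft _).obj (ModuleCat.of R K)) (i + 1)).symm)

theorem torLen_one (hf : Function.Injective f) (hfg : Function.Exact f g)
    (hg : Function.Surjective g) :
    torLen R 1 X Y = Module.length R (LinearMap.ker (f.rTensor Y)) := by
  let S : ShortComplex (ModuleCat.{0} R) :=
    ShortComplex.mk (ModuleCat.ofHom f) (ModuleCat.ofHom g)
      (ModuleCat.hom_ext hfg.linearMap_comp_eq_zero)
  have hS : S.ShortExact :=
    { exact := (ShortComplex.ShortExact.moduleCat_exact_iff_function_exact _).2 hfg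
      mono_f := (ModuleCat.mono_iff_injective _).2 hf
      epi_g := (ModuleCat.epi_iff_surjective _).2 hg }
  let P := projectiveResolution (ModuleCat.of R Y)
  have hP := P.tensorShortComplex_shortExact hS
  have hmono : Mono (hP.δ 1 0 (by simp)) :=
    hP.mono_δ 1 0 (by simp) (P.isZero_homology_tensorComplex (ModuleCat.of R F) 0)
  have hex := hP.homology_exact₁ 1 0 (by simp)
  let d : (P.tensorComplex (ModuleCat.of R X)).homology 1 ⟶
      ModuleCat.of R K ⊗ ModuleCat.of R Y :=
    hP.δ 1 0 (by simp) ≫ (P.homologyZeroTensorIso (ModuleCat.of R K)).hom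
  have hnat := P.homologyZeroTensorIso_naturality (ModuleCat.ofHom f)
  have hd : (ShortComplex.mk d (ModuleCat.ofHom f ▷ ModuleCat.of R Y) (by
      rw [Category.assoc, ← hnat]
      exact hP.δ_comp_assoc 1 0 (by simp) _ |>.trans zero_comp)).Exact := by
    refine (ShortComplex.exact_iff_of_iso ?_).1 hex
    exact ShortComplex.isoMk (Iso.refl _) (P.homologyZeroTensorIso (ModuleCat.of R K))
      (P.homologyZeroTensorIso (ModuleCat.of R F)) (Category.id_comp _) hnat.symm
  have hdinj : Function.Injective d.hom := by
    rw [← ModuleCat.mono_iff_injective]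
    infer_instance
  have hker : LinearMap.range d.hom = LinearMap.ker (f.rTensor Y) :=
    hd.moduleCat_range_eq_ker
  calc torLen R 1 X Y
      = Module.length R ((P.tensorComplex (ModuleCat.of R X)).homology 1) :=
        ModuleCat.length_eq_of_iso
          (P.isoLeftDerivedObj ((tensoringLeft _).obj (ModuleCat.of R X)) 1)
    _ = Module.length R (LinearMap.range d.hom) :=
        (LinearEquiv.ofInjective d.hom hdinj).length_eq
    _ = Module.length R (LinearMap.ker (f.rTensor Y)) :=
        (LinearEquiv.ofEq _ _ hker).length_eq

end

end TorLength

section TensorQuotient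

open scoped TensorProduct

variable {R : Type} [CommRing R] {K F N : Type} [AddCommGroup K] [Module R K]
  [AddCommGroup F] [Module R F] [AddCommGroup N] [Module R N] (I : Ideal R)

theorem LinearMap.ker_lTensor_mkQ_smul_top :
    LinearMap.ker ((I • (⊤ : Submodule R N)).mkQ.lTensor K) = I • ⊤ := by
  rw [(lTensor_exact K (LinearMap.exact_subtype_mkQ (I • (⊤ : Submodule R N)))
    (Submodule.mkQ_surjective _)).linearMap_ker_eq]
  apply le_antisymm
  · rintro _ ⟨t, rfl⟩
    induction t using TensorProduct.induction_on with
    | zero => simp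
    | add s t hs ht => rw [map_add]; exact add_mem hs ht
    | tmul k n =>
      suffices ∀ n ∈ I • (⊤ : Submodule R N), k ⊗ₜ[R] n ∈ I • (⊤ : Submodule R (K ⊗[R] N)) from
        this n n.2
      intro n hn
      refine Submodule.smul_induction_on hn (fun r hr n _ => ?_) fun x y hx hy => ?_
      · rw [TensorProduct.tmul_smul]
        exact Submodule.smul_mem_smul hr trivial
      · rw [TensorProduct.tmul_add]
        exact add_mem hx hy
  · rw [Submodule.smul_le]
    intro r hr t _
    induction t using TensorProduct.induction_on with
    | zero => simp
    | add s t hs ht => rw [smul_add]; exact add_mem (hs trivial) (ht trivial)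
    | tmul k n =>
      rw [← TensorProduct.tmul_smul]
      exact ⟨k ⊗ₜ ⟨r • n, Submodule.smul_mem_smul hr trivial⟩, rfl⟩

theorem length_ker_rTensor_quotient (f : K →ₗ[R] F) :
    Module.length R (LinearMap.ker (f.rTensor (N ⧸ (I • (⊤ : Submodule R N))))) =
      relLen (I • ⊤) (Submodule.comap (f.rTensor N) (I • ⊤)) := by
  let qK := (I • (⊤ : Submodule R N)).mkQ.lTensor K
  let qF := (I • (⊤ : Submodule R N)).mkQ.lTensor F
  have hqK : Function.Surjective qK := LinearMap.lTensor_surjective K (Submodule.mkQ_surjective _)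
  have hK : LinearMap.ker qK = I • ⊤ := LinearMap.ker_lTensor_mkQ_smul_top I
  have hF : LinearMap.ker qF = I • ⊤ := LinearMap.ker_lTensor_mkQ_smul_top I
  have hcomm : (f.rTensor _).comp qK = qF.comp (f.rTensor N) := by
    simp only [qK, qF, LinearMap.rTensor_comp_lTensor, LinearMap.lTensor_comp_rTensor]
  have hker : LinearMap.ker (f.rTensor (N ⧸ (I • (⊤ : Submodule R N)))) =
      (Submodule.comap (f.rTensor N) (I • ⊤)).map qK := by
    rw [← hF, ← LinearMap.ker_comp, ← hcomm, LinearMap.ker_comp,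
      Submodule.map_comap_eq_of_surjective hqK]
  have hbot : (⊥ : Submodule R (K ⊗[R] (N ⧸ (I • (⊤ : Submodule R N))))) =
      Submodule.map qK (I • ⊤) := by
    rw [← hK, (LinearMap.le_ker_iff_map (f := qK)).1 le_rfl]
  rw [← relLen_bot, hker, hbot, relLen_map qK _ hK.le]
  rw [← Submodule.map_le_iff_le_comap, Submodule.map_smul'']
  exact Submodule.smul_mono le_rfl le_top

theorem length_tensor_quotient :
    Module.length R (K ⊗[R] (N ⧸ (I • (⊤ : Submodule R N)))) =
      relLen (I • ⊤) (Submodule.comap (0 : K ⊗[R] N →ₗ[R] K ⊗[R] N) (I • ⊤)) := by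
  have h := length_ker_rTensor_quotient (N := N) I (0 : K →ₗ[R] K)
  rw [LinearMap.rTensor_zero, LinearMap.rTensor_zero, LinearMap.ker_zero, Module.length_top] at h
  exact h

end TensorQuotient

namespace GradedOp

variable {R : Type} [CommRing R] {a : ℕ} {A B X : GradedOp R a}

theorem isEvPolyLength_length_ker_rTensor [IsNoetherianRing R] (J : Ideal R) (N : Type)
    [AddCommGroup N] [Module R N] [Module.Finite R N] (hA : A.FG) (hB : B.FG)
    (φ : ∀ n, A.carrier n →ₗ[R] B.carrier n)
    (hφ : ∀ k n v, φ (n + 1) (A.op k n v) = B.op k n (φ n v))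
    (hfin : ∃ c, ∀ m ≥ c, ∀ n ≥ c, Module.length R
      (LinearMap.ker ((φ n).rTensor (N ⧸ (J ^ m • (⊤ : Submodule R N))))) ≠ ⊤) :
    IsEvPolyLength fun m n => Module.length R
      (LinearMap.ker ((φ n).rTensor (N ⧸ (J ^ m • (⊤ : Submodule R N))))) := by
  simp only [length_ker_rTensor_quotient] at hfin ⊢
  refine isEvPolyLength_relLen_comap (A := A.tensor N) (B := B.tensor N) (J := J)
    (hA.tensor N) (hB.tensor N) (φ := fun n => (φ n).rTensor N) (fun k n v => ?_) hfin
  have h : ((φ (n + 1)).rTensor N).comp ((A.op k n).rTensor N) =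
      ((B.op k n).rTensor N).comp ((φ n).rTensor N) := by
    rw [← LinearMap.rTensor_comp, ← LinearMap.rTensor_comp]
    congr 1
    exact LinearMap.ext (hφ k n)
  exact LinearMap.congr_fun h v

/-- Lengths of `Tor` of a graded family with the adic quotients of a module are eventually
polynomial. -/
theorem FG.isEvPolyLength_torLen [IsNoetherianRing R] (J : Ideal R) (N : Type) [AddCommGroup N]
    [Module R N] [Module.Finite R N] (hX : X.FG) (i : ℕ)
    (hfin : ∃ c, ∀ m ≥ c, ∀ n ≥ c,
      torLen R i (X.carrier n) (N ⧸ (J ^ m • (⊤ : Submodule R N))) ≠ ⊤) :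
    IsEvPolyLength fun m n => torLen R i (X.carrier n) (N ⧸ (J ^ m • (⊤ : Submodule R N))) := by
  induction i using Nat.strong_induction_on generalizing X with
  | _ i ih =>
  rcases i with _ | i
  · simp only [torLen_zero, length_tensor_quotient] at hfin ⊢
    exact isEvPolyLength_relLen_comap (hX.tensor N) (hX.tensor N) (φ := fun _ => 0)
      (fun k n v => by simp) hfin
  · obtain ⟨F, π, hF, hfree, hπ, hsurj⟩ := hX.exists_free_cover
    have hK : F.Stable fun n => LinearMap.ker (π n) := fun k n v hv => by
      rw [LinearMap.mem_ker] at hv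
      rw [Submodule.mem_comap, LinearMap.mem_ker, hπ, hv, map_zero]
    have hex : ∀ n, Function.Exact (LinearMap.ker (π n)).subtype (π n) := fun n =>
      LinearMap.exact_subtype_ker_map (π n)
    have hinj : ∀ n, Function.Injective (LinearMap.ker (π n)).subtype := fun n =>
      Submodule.injective_subtype _
    rcases i with _ | i
    · simp only [fun m n => torLen_one (Y := N ⧸ (J ^ m • (⊤ : Submodule R N))) (hinj n) (hex n)
        (hsurj n), zero_add] at hfin ⊢
      exact isEvPolyLength_length_ker_rTensor (A := GradedOp.ofStable hK) J N (hF.ofStable hK) hF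
        (fun n => (LinearMap.ker (π n)).subtype) (fun _ _ _ => rfl) hfin
    · simp only [fun m n => torLen_succ_succ (Y := N ⧸ (J ^ m • (⊤ : Submodule R N))) (hinj n)
        (hex n) (hsurj n) i, add_assoc, one_add_one_eq_two] at hfin ⊢
      exact ih (i + 1) (by omega) (X := GradedOp.ofStable hK) (hF.ofStable hK) hfin

end GradedOp

namespace GradedOp

variable {R : Type} [CommRing R] {a : ℕ} (M : Type) [AddCommGroup M] [Module R M]

/-- The constant graded family on which the operators are multiplications by scalars. -/
def const (x : Fin a → R) : GradedOp R a where
  carrier _ := M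
  op k _ := LinearMap.lsmul R M (x k)
  comm k l _ v := smul_comm (x k) (x l) v

theorem const_stable_pow {x : Fin a → R} {I : Ideal R} (hx : Ideal.span (Set.range x) = I) :
    (const M x).Stable fun n => I ^ n • (⊤ : Submodule R ((const M x).carrier n)) := by
  intro k n v hv
  change x k • (v : M) ∈ I ^ (n + 1) • (⊤ : Submodule R M)
  rw [pow_succ', Submodule.mul_smul]
  have hk : x k ∈ I := hx ▸ Ideal.subset_span ⟨k, rfl⟩
  exact Submodule.smul_mem_smul (M := M) hk hv

theorem pow_fg [IsNoetherianRing R] [Module.Finite R M] {x : Fin a → R} {I : Ideal R}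
    (hx : Ideal.span (Set.range x) = I) : (ofStable (const_stable_pow M hx)).FG := by
  refine ofStable_fg _ (fun n => ?_) ⟨0, fun n _ => le_antisymm ?_ ?_⟩
  · exact inferInstanceAs (Module.Finite R ↥(I ^ n • (⊤ : Submodule R M)))
  · change I ^ (n + 1) • (⊤ : Submodule R M) ≤
      ⨆ k, (I ^ n • (⊤ : Submodule R M)).map (LinearMap.lsmul R M (x k))
    rw [pow_succ', Submodule.mul_smul, Submodule.smul_le]
    intro r hr v hv
    rw [← hx] at hr
    induction hr using Submodule.span_induction with
    | mem r hr =>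
      obtain ⟨k, rfl⟩ := hr
      exact Submodule.mem_iSup_of_mem k ⟨v, hv, rfl⟩
    | zero => rw [zero_smul]; exact zero_mem _
    | add r s _ _ hr hs => rw [add_smul]; exact add_mem hr hs
    | smul t r _ hr => rw [smul_assoc]; exact Submodule.smul_mem _ t hr
  · exact iSup_le fun k => Submodule.map_le_iff_le_comap.2 (const_stable_pow M hx k n)

end GradedOp

theorem stmt0 (R : Type) [CommRing R] [IsNoetherianRing R]
    (I J : Ideal R)
    (M : Type) [AddCommGroup M] [Module R M] [Module.Finite R M]
    (N : Type) [AddCommGroup N] [Module R N] [Module.Finite R N]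
    (i : ℕ)
    (hfin : ∃ m₁ n₁ : ℕ, ∀ m, m₁ ≤ m → ∀ n, n₁ ≤ n →
      IsFiniteLength R ↥(TorM R i (↥(I ^ n • (⊤ : Submodule R M)))
        (N ⧸ (J ^ m • (⊤ : Submodule R N))))) :
    ∃ (p : MvPolynomial (Fin 2) ℚ) (m₀ n₀ : ℕ), ∀ m, m₀ ≤ m → ∀ n, n₀ ≤ n →
      ∃ c : ℕ,
        modLength R ↥(TorM R i (↥(I ^ n • (⊤ : Submodule R M)))
          (N ⧸ (J ^ m • (⊤ : Submodule R N)))) = (c : ℕ∞) ∧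
        (c : ℚ) = MvPolynomial.eval ![(m : ℚ), (n : ℚ)] p := by
  obtain ⟨a, x, hx⟩ := Submodule.fg_iff_exists_fin_generating_family.1 (IsNoetherian.noetherian I)
  obtain ⟨m₁, n₁, hfin⟩ := hfin
  have h : IsEvPolyLength fun m n => torLen R i ↥(I ^ n • (⊤ : Submodule R M))
      (N ⧸ (J ^ m • (⊤ : Submodule R N))) :=
    (GradedOp.pow_fg M hx).isEvPolyLength_torLen J N i ⟨max m₁ n₁, fun m hm n hn =>
      Module.length_ne_top_iff.2 (hfin m (by omega) n (by omega))⟩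
  obtain ⟨⟨c₁, hc₁⟩, p, c₂, hp⟩ := h
  refine ⟨p, max c₁ c₂, max c₁ c₂, fun m hm n hn => ⟨_, ?_, hp m (by omega) n (by omega)⟩⟩
  rw [ENat.natCast_toNat (hc₁ m (by omega) n (by omega))]
  exact (Module.coe_length R _).symm
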